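/- Let Σ = diag(λ₁,…,λ_p), s = trace(Σ), β ∈ ℝ^p, and φ ∈ ℝ^{p×d} with i.i.d. N(0,1/d) entries. Then min_{v∈ℝ^p} E_φ[‖Xβ − Xφφ'v‖²] = Σ_{i=1}^p β_i² λ_i w_i, where w_i = [(1+1/d)λ_i² + (1+2/d)λ_i s + s²/d] / [(d+2+1/d)λ_i² + 2(1+1/d)λ_i s + s²/d], attained at v_i = β_i λ_i / ((1+1/d)λ_i + s/d). -/

import Mathlib

open MeasureTheory ProbabilityTheory Matrix
open scoped NNReal

lemma integral_pow_two_and_pow_four_gaussianReal (v : ℝ≥0) :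
    (∫ x, x ^ 2 ∂gaussianReal 0 v) = v ∧ (∫ x, x ^ 4 ∂gaussianReal 0 v) = 3 * (v : ℝ) ^ 2 := by
  have key : ∀ n : ℕ, iteratedDeriv n (mgf (fun x : ℝ ↦ x) (gaussianReal 0 v)) 0
      = ∫ x, x ^ n ∂gaussianReal 0 v := fun n ↦
    iteratedDeriv_mgf_zero (by simp [integrableExpSet_fun_id_gaussianReal]) n
  have he : ∀ t : ℝ, HasDerivAt (fun t : ℝ ↦ Real.exp (v * t ^ 2 / 2))
      (v * t * Real.exp (v * t ^ 2 / 2)) t := fun t ↦ by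
    convert! ((((hasDerivAt_id t).pow 2).const_mul (v : ℝ)).div_const 2).exp using 1
    simp; ring
  have hmul : ∀ P P' : ℝ → ℝ, (∀ t, HasDerivAt P (P' t) t) →
      deriv (fun t ↦ P t * Real.exp (v * t ^ 2 / 2))
        = fun t ↦ (P' t + v * t * P t) * Real.exp (v * t ^ 2 / 2) := fun P P' h ↦ by
    ext t
    rw [((h t).fun_mul (he t)).deriv]
    ring
  have h0 : mgf (fun x : ℝ ↦ x) (gaussianReal 0 v)
      = fun t ↦ 1 * Real.exp (v * t ^ 2 / 2) := by
    ext t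
    simp [mgf_fun_id_gaussianReal]
  have h1 := hmul (fun _ ↦ 1) (fun _ ↦ 0) (fun t ↦ hasDerivAt_const t 1)
  have h2 := hmul (fun t ↦ 0 + v * t * 1) (fun _ ↦ v) (fun t ↦ by
    simpa using (hasDerivAt_id t).const_mul (v : ℝ))
  have h3 := hmul (fun t ↦ v + v * t * (0 + v * t * 1)) (fun t ↦ 2 * v ^ 2 * t) (fun t ↦ by
    convert! (((hasDerivAt_id t).pow 2).const_mul ((v : ℝ) ^ 2)).const_add (v : ℝ) using 1
    · ext; simp; ring
    · simp; ring)
  have h4 := hmul (fun t ↦ 2 * v ^ 2 * t + v * t * (v + v * t * (0 + v * t * 1)))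
    (fun t ↦ 3 * v ^ 2 + 3 * v ^ 3 * t ^ 2) (fun t ↦ by
    convert! ((hasDerivAt_id t).const_mul (3 * (v : ℝ) ^ 2)).add
      (((hasDerivAt_id t).pow 3).const_mul ((v : ℝ) ^ 3)) using 1
    · ext; simp; ring
    · simp; ring)
  refine ⟨?_, ?_⟩
  · rw [← key]
    simp only [iteratedDeriv_succ, iteratedDeriv_zero, h0, h1, h2]
    simp
  · rw [← key]
    simp only [iteratedDeriv_succ, iteratedDeriv_zero, h0, h1, h2, h3, h4]
    simp

lemma integrable_pow_gaussianReal (v : ℝ≥0) (n : ℕ) :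
    Integrable (fun x ↦ x ^ n) (gaussianReal 0 v) := by
  have h := (memLp_id_gaussianReal (μ := 0) (v := v) n).integrable_norm_pow'
  rw [← integrable_norm_iff (by fun_prop)]
  simpa using h

section Monomials

variable {ι : Type*} [Fintype ι] [DecidableEq ι]

lemma prod_moment_two (M : ℕ → ℝ) (v : ℝ) (h0 : M 0 = 1) (h1 : M 1 = 0) (h2 : M 2 = v)
    (a b : ι) :
    ∏ x, M ((if x = a then 1 else 0) + (if x = b then 1 else 0)) = if a = b then v else 0 := by
  split_ifs with h
  · subst h
    rw [Finset.prod_eq_single a] <;> simp +contextual [h0, h2]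
  · exact Finset.prod_eq_zero (Finset.mem_univ a) (by simp [h, h1])

lemma prod_moment_four (M : ℕ → ℝ) (v : ℝ) (h0 : M 0 = 1) (h1 : M 1 = 0) (h2 : M 2 = v)
    (h4 : M 4 = 3 * v ^ 2) (a b c d : ι) :
    ∏ x, M ((if x = a then 1 else 0) + (if x = b then 1 else 0) + (if x = c then 1 else 0)
        + (if x = d then 1 else 0))
      = v ^ 2 * ((if a = b then 1 else 0) * (if c = d then 1 else 0)
        + (if a = c then 1 else 0) * (if b = d then 1 else 0)
        + (if a = d then 1 else 0) * (if b = c then 1 else 0)) := by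
  have pair : ∀ {a b : ι}, a ≠ b → ∀ f : ι → ℕ, f a = 2 → f b = 2 →
      (∀ x, x ≠ a → x ≠ b → f x = 0) → ∏ x, M (f x) = v ^ 2 := by
    intro a b hab f ha hb hx
    rw [Finset.prod_eq_mul a b hab (fun x _ h ↦ by rw [hx x h.1 h.2, h0]) (by simp) (by simp),
      ha, hb, h2, sq]
  have single : ∀ (a : ι) (f : ι → ℕ), f a = 1 → ∏ x, M (f x) = 0 := fun a f ha ↦
    Finset.prod_eq_zero (Finset.mem_univ a) (by rw [ha, h1])
  by_cases hab : a = b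
  · subst hab
    by_cases hcd : c = d
    · subst hcd
      by_cases hac : a = c
      · subst hac
        rw [Finset.prod_eq_single a] <;> simp +contextual [h0, h4]
        ring
      · rw [pair hac] <;> simp +contextual [hac, Ne.symm hac]
    · by_cases hac : a = c
      · subst hac
        rw [single d] <;> simp [hcd, Ne.symm hcd]
      · rw [single c] <;> simp [hcd, hac, Ne.symm hac]
  · by_cases hac : a = c
    · subst hac
      by_cases hbd : b = d
      · subst hbd
        rw [pair hab] <;> simp +contextual [hab, Ne.symm hab]
      · rw [single b] <;> simp [hab, hbd, Ne.symm hab]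
    · by_cases had : a = d
      · subst had
        by_cases hbc : b = c
        · subst hbc
          rw [pair hab] <;> simp +contextual [hab, Ne.symm hab]
        · rw [single b] <;> simp [hab, hbc, Ne.symm hab]
      · rw [single a] <;> simp [hab, hac, had]

end Monomials

section GaussianMatrix

variable {p d : ℕ}

/-- The law of a `p × d` matrix with independent centred Gaussian entries of variance `v`. -/
noncomputable abbrev gaussianMatrix (p d : ℕ) (v : ℝ≥0) : Measure (Fin p → Fin d → ℝ) :=
  Measure.pi fun _ : Fin p ↦ Measure.pi fun _ : Fin d ↦ gaussianReal 0 v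

lemma integrable_monomial_gaussianMatrix (v : ℝ≥0) (n : Fin p × Fin d → ℕ) :
    Integrable (fun φ ↦ ∏ x : Fin p × Fin d, φ x.1 x.2 ^ n x) (gaussianMatrix p d v) := by
  simp_rw [Fintype.prod_prod_type]
  exact Integrable.fintype_prod (f := fun i (y : Fin d → ℝ) ↦ ∏ j, y j ^ n (i, j)) fun i ↦
    Integrable.fintype_prod (f := fun j (y : ℝ) ↦ y ^ n (i, j)) fun j ↦
      integrable_pow_gaussianReal v _

lemma integral_monomial_gaussianMatrix (v : ℝ≥0) (n : Fin p × Fin d → ℕ) :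
    ∫ φ, ∏ x : Fin p × Fin d, φ x.1 x.2 ^ n x ∂gaussianMatrix p d v
      = ∏ x, ∫ y, y ^ n x ∂gaussianReal 0 v := by
  simp_rw [Fintype.prod_prod_type]
  rw [integral_fintype_prod_eq_prod (fun i (y : Fin d → ℝ) ↦ ∏ j, y j ^ n (i, j))]
  refine Finset.prod_congr rfl fun i _ ↦ ?_
  rw [integral_fintype_prod_eq_prod (fun j (y : ℝ) ↦ y ^ n (i, j))]

lemma monomial_two (φ : Fin p → Fin d → ℝ) (a b : Fin p × Fin d) :
    φ a.1 a.2 * φ b.1 b.2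
      = ∏ x : Fin p × Fin d, φ x.1 x.2 ^ ((if x = a then 1 else 0) + (if x = b then 1 else 0)) := by
  simp only [pow_add, Finset.prod_mul_distrib, pow_ite]
  simp

lemma monomial_four (φ : Fin p → Fin d → ℝ) (a b c e : Fin p × Fin d) :
    φ a.1 a.2 * φ b.1 b.2 * φ c.1 c.2 * φ e.1 e.2
      = ∏ x : Fin p × Fin d, φ x.1 x.2 ^ ((if x = a then 1 else 0) + (if x = b then 1 else 0)
        + (if x = c then 1 else 0) + (if x = e then 1 else 0)) := by
  simp only [pow_add, Finset.prod_mul_distrib, pow_ite]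
  simp

lemma hasIntegral_mul_gaussianMatrix (v : ℝ≥0) (a b : Fin p × Fin d) :
    Integrable (fun φ ↦ φ a.1 a.2 * φ b.1 b.2) (gaussianMatrix p d v) ∧
    ∫ φ, φ a.1 a.2 * φ b.1 b.2 ∂gaussianMatrix p d v = if a = b then (v : ℝ) else 0 := by
  simp_rw [monomial_two]
  refine ⟨integrable_monomial_gaussianMatrix v _, ?_⟩
  rw [integral_monomial_gaussianMatrix]
  exact prod_moment_two (fun n ↦ ∫ y, y ^ n ∂gaussianReal 0 v) v (by simp) (by simp)
    (integral_pow_two_and_pow_four_gaussianReal v).1 a b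

lemma hasIntegral_mul_four_gaussianMatrix (v : ℝ≥0) (a b c e : Fin p × Fin d) :
    Integrable (fun φ ↦ φ a.1 a.2 * φ b.1 b.2 * φ c.1 c.2 * φ e.1 e.2) (gaussianMatrix p d v) ∧
    ∫ φ, φ a.1 a.2 * φ b.1 b.2 * φ c.1 c.2 * φ e.1 e.2 ∂gaussianMatrix p d v
      = (v : ℝ) ^ 2 * ((if a = b then 1 else 0) * (if c = e then 1 else 0)
        + (if a = c then 1 else 0) * (if b = e then 1 else 0)
        + (if a = e then 1 else 0) * (if b = c then 1 else 0)) := by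
  simp_rw [monomial_four]
  refine ⟨integrable_monomial_gaussianMatrix v _, ?_⟩
  rw [integral_monomial_gaussianMatrix]
  exact prod_moment_four (fun n ↦ ∫ y, y ^ n ∂gaussianReal 0 v) v (by simp) (by simp)
    (integral_pow_two_and_pow_four_gaussianReal v).1 (integral_pow_two_and_pow_four_gaussianReal v).2 a b c e

lemma of_mul_transpose_mulVec_apply (φ : Fin p → Fin d → ℝ) (u : Fin p → ℝ) (l : Fin p) :
    ((Matrix.of φ * (Matrix.of φ)ᵀ) *ᵥ u) l = ∑ m, ∑ k, u m * (φ l k * φ m k) := by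
  simp [mulVec, dotProduct, Matrix.mul_apply, ← Finset.mul_sum, mul_comm]

lemma hasIntegral_mulVec_gaussianMatrix (v : ℝ≥0) (u : Fin p → ℝ) (l : Fin p) :
    Integrable (fun φ ↦ ((Matrix.of φ * (Matrix.of φ)ᵀ) *ᵥ u) l) (gaussianMatrix p d v) ∧
    ∫ φ, ((Matrix.of φ * (Matrix.of φ)ᵀ) *ᵥ u) l ∂gaussianMatrix p d v = d * v * u l := by
  simp_rw [of_mul_transpose_mulVec_apply]
  have hI : ∀ m k, Integrable (fun φ : Fin p → Fin d → ℝ ↦ u m * (φ l k * φ m k))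
      (gaussianMatrix p d v) := fun m k ↦
    (hasIntegral_mul_gaussianMatrix v (l, k) (m, k)).1.const_mul _
  refine ⟨integrable_finsetSum _ fun m _ ↦ integrable_finsetSum _ fun k _ ↦ hI m k, ?_⟩
  rw [integral_finsetSum _ fun m _ ↦ integrable_finsetSum _ fun k _ ↦ hI m k]
  have : ∀ m, ∫ φ, ∑ k, u m * (φ l k * φ m k) ∂gaussianMatrix p d v
      = if l = m then d * (v * u m) else 0 := fun m ↦ by
    rw [integral_finsetSum _ fun k _ ↦ hI m k]
    simp_rw [integral_const_mul]
    have h := fun k ↦ (hasIntegral_mul_gaussianMatrix (p := p) (d := d) v (l, k) (m, k)).2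
    simp only at h
    simp_rw [h]
    by_cases hlm : l = m <;> simp [hlm, mul_comm]
  simp_rw [this]
  simp [mul_assoc]

lemma hasIntegral_mulVec_sq_gaussianMatrix (v : ℝ≥0) (u : Fin p → ℝ) (l : Fin p) :
    Integrable (fun φ ↦ ((Matrix.of φ * (Matrix.of φ)ᵀ) *ᵥ u) l ^ 2) (gaussianMatrix p d v) ∧
    ∫ φ, ((Matrix.of φ * (Matrix.of φ)ᵀ) *ᵥ u) l ^ 2 ∂gaussianMatrix p d v
      = v ^ 2 * ((d ^ 2 + d) * u l ^ 2 + d * ∑ m, u m ^ 2) := by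
  have hexp : ∀ φ : Fin p → Fin d → ℝ, ((Matrix.of φ * (Matrix.of φ)ᵀ) *ᵥ u) l ^ 2
      = ∑ m, ∑ m', ∑ k, ∑ k', u m * u m' * (φ l k * φ m k * φ l k' * φ m' k') := fun φ ↦ by
    rw [of_mul_transpose_mulVec_apply, sq, Finset.sum_mul_sum]
    refine Finset.sum_congr rfl fun m _ ↦ Finset.sum_congr rfl fun m' _ ↦ ?_
    rw [Finset.sum_mul_sum]
    refine Finset.sum_congr rfl fun k _ ↦ Finset.sum_congr rfl fun k' _ ↦ ?_
    ring
  simp_rw [hexp]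
  have hI : ∀ m m' k k', Integrable (fun φ : Fin p → Fin d → ℝ ↦
      u m * u m' * (φ l k * φ m k * φ l k' * φ m' k')) (gaussianMatrix p d v) := fun m m' k k' ↦
    (hasIntegral_mul_four_gaussianMatrix v (l, k) (m, k) (l, k') (m', k')).1.const_mul _
  have hI1 := fun m m' k ↦ integrable_finsetSum Finset.univ fun k' _ ↦ hI m m' k k'
  have hI2 := fun m m' ↦ integrable_finsetSum Finset.univ fun k _ ↦ hI1 m m' k
  have hI3 := fun m ↦ integrable_finsetSum Finset.univ fun m' _ ↦ hI2 m m'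
  refine ⟨integrable_finsetSum _ fun m _ ↦ hI3 m, ?_⟩
  have hval : ∀ m m', ∫ φ, ∑ k, ∑ k', u m * u m' * (φ l k * φ m k * φ l k' * φ m' k')
      ∂gaussianMatrix p d v
      = v ^ 2 * ((if l = m then u m else 0) * (if l = m' then u m' else 0) * (d ^ 2 + d)
        + d * (if m = m' then u m * u m' else 0)) := fun m m' ↦ by
    rw [integral_finsetSum _ fun k _ ↦ hI1 m m' k,
      Finset.sum_congr rfl fun k _ ↦ integral_finsetSum _ fun k' _ ↦ hI m m' k k']
    simp_rw [integral_const_mul]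
    have h := fun k k' ↦
      (hasIntegral_mul_four_gaussianMatrix (p := p) (d := d) v (l, k) (m, k) (l, k') (m', k')).2
    simp only at h
    simp_rw [h]
    by_cases hlm : l = m <;> by_cases hlm' : l = m' <;> by_cases hmm : m = m' <;>
      simp_all [Finset.sum_add_distrib, ← Finset.mul_sum, mul_add] <;> ring
  rw [integral_finsetSum _ fun m _ ↦ hI3 m,
    Finset.sum_congr rfl fun m _ ↦ integral_finsetSum _ fun m' _ ↦ hI2 m m']
  simp_rw [hval]
  simp only [← Finset.mul_sum, ← Finset.sum_mul, Finset.sum_add_distrib]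
  simp
  ring_nf
  simp

/-- The second moment of a coordinate of `β - φφᵀu`. -/
lemma hasIntegral_sub_mulVec_sq_gaussianMatrix (v : ℝ≥0) (b : ℝ) (u : Fin p → ℝ) (l : Fin p) :
    Integrable (fun φ ↦ (b - ((Matrix.of φ * (Matrix.of φ)ᵀ) *ᵥ u) l) ^ 2)
      (gaussianMatrix p d v) ∧
    ∫ φ, (b - ((Matrix.of φ * (Matrix.of φ)ᵀ) *ᵥ u) l) ^ 2 ∂gaussianMatrix p d v
      = b ^ 2 - 2 * b * (d * v * u l) + v ^ 2 * ((d ^ 2 + d) * u l ^ 2 + d * ∑ m, u m ^ 2) := by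
  obtain ⟨i1, e1⟩ := hasIntegral_mulVec_gaussianMatrix (d := d) v u l
  obtain ⟨i2, e2⟩ := hasIntegral_mulVec_sq_gaussianMatrix (d := d) v u l
  simp_rw [sub_sq]
  have i0 : Integrable (fun φ ↦ b ^ 2 - 2 * b * ((Matrix.of φ * (Matrix.of φ)ᵀ) *ᵥ u) l)
      (gaussianMatrix p d v) := (integrable_const _).sub (i1.const_mul (2 * b))
  refine ⟨i0.add i2, ?_⟩
  rw [integral_add i0 i2, integral_sub (integrable_const _) (i1.const_mul _), integral_const_mul,
    e1, e2]
  simp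

end GaussianMatrix

/-- If `XᵀX` is diagonal then `‖Xu‖²` is the corresponding weighted sum of squares. -/
lemma sum_mulVec_sq_of_transpose_mul_eq_diagonal {m ι R : Type*} [Fintype m] [Fintype ι]
    [DecidableEq ι] [CommRing R] {X : Matrix m ι R} {lam : ι → R}
    (h : Xᵀ * X = Matrix.diagonal lam) (u : ι → R) :
    ∑ i, (X *ᵥ u) i ^ 2 = ∑ l, lam l * u l ^ 2 := by
  calc ∑ i, (X *ᵥ u) i ^ 2 = (X *ᵥ u) ⬝ᵥ (X *ᵥ u) := by simp [dotProduct, sq]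
    _ = u ⬝ᵥ ((Xᵀ * X) *ᵥ u) := by
      rw [← Matrix.mulVec_mulVec, Matrix.dotProduct_mulVec u, Matrix.vecMul_transpose]
    _ = ∑ l, lam l * u l ^ 2 := by
      rw [h]
      simp only [dotProduct, mulVec_diagonal]
      exact Finset.sum_congr rfl fun l _ ↦ by ring

/-- The value of the quadratic `x ↦ lb² - 2lbx + ((1 + 1/d)l + s/d)x²` at its critical point, and
its minimality. -/
lemma quadratic_min {l s d b : ℝ} (hd : 0 < d) (hl : 0 ≤ l) (hls : l ≤ s) :
    let w := ((1 + 1 / d) * l ^ 2 + (1 + 2 / d) * l * s + s ^ 2 / d)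
      / ((d + 2 + 1 / d) * l ^ 2 + 2 * (1 + 1 / d) * l * s + s ^ 2 / d)
    let A := (1 + 1 / d) * l + s / d
    let x₀ := b * l / A
    (∀ x, b ^ 2 * l * w ≤ l * b ^ 2 - 2 * l * b * x + A * x ^ 2) ∧
      l * b ^ 2 - 2 * l * b * x₀ + A * x₀ ^ 2 = b ^ 2 * l * w := by
  intro w A x₀
  rcases hl.eq_or_lt with rfl | hl
  · have hA : 0 ≤ A := by positivity
    refine ⟨fun x ↦ ?_, by simp [x₀]⟩
    simp only [mul_zero, zero_mul, sub_zero, zero_add]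
    positivity
  have hs : 0 < s := hl.trans_le hls
  have hA : 0 < A := by positivity
  have hw : w = (A - l) / A := by
    have hD : 0 < (d + 2 + 1 / d) * l ^ 2 + 2 * (1 + 1 / d) * l * s + s ^ 2 / d := by positivity
    rw [div_eq_div_iff hD.ne' hA.ne']
    simp only [A]
    field_simp
    ring
  have hx₀ : l * b ^ 2 - 2 * l * b * x₀ + A * x₀ ^ 2 = b ^ 2 * l * w := by
    rw [hw]
    simp only [x₀]
    field_simp
    ring
  refine ⟨fun x ↦ ?_, hx₀⟩
  have hb : b * l = A * x₀ := by simp only [x₀]; field_simp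
  rw [← hx₀]
  have hgap : l * b ^ 2 - 2 * l * b * x + A * x ^ 2 - (l * b ^ 2 - 2 * l * b * x₀ + A * x₀ ^ 2)
      = A * (x - x₀) ^ 2 := by linear_combination 2 * (x₀ - x) * hb
  nlinarith [mul_nonneg hA.le (sq_nonneg (x - x₀))]

/-- With `XᵀX = diag λ`, `s = trace Σ`, and `φ` with i.i.d. `N(0,1/d)` entries:
`min_{v} E_φ‖Xβ − Xφφᵀv‖² = ∑ᵢ βᵢ²λᵢwᵢ`, attained at
`vᵢ = βᵢλᵢ/((1+1/d)λᵢ + s/d)`. -/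
theorem stmt11 (n p d : ℕ) (hd : 0 < d)
    (X : Matrix (Fin n) (Fin p) ℝ) (β : Fin p → ℝ) (lam : Fin p → ℝ)
    (hdiag : Xᵀ * X = Matrix.diagonal lam)
    (μ : Measure (Fin p → Fin d → ℝ))
    (hμ : μ = Measure.pi fun _ : Fin p => Measure.pi fun _ : Fin d =>
      gaussianReal 0 ((d : ℝ≥0))⁻¹)
    (s : ℝ) (hs : s = (Xᵀ * X).trace)
    (w : Fin p → ℝ)
    (hw : ∀ i, w i = ((1 + 1 / (d : ℝ)) * (lam i) ^ 2 + (1 + 2 / (d : ℝ)) * lam i * s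
        + s ^ 2 / (d : ℝ))
      / (((d : ℝ) + 2 + 1 / (d : ℝ)) * (lam i) ^ 2 + 2 * (1 + 1 / (d : ℝ)) * lam i * s
        + s ^ 2 / (d : ℝ)))
    (vstar : Fin p → ℝ)
    (hv : ∀ i, vstar i = β i * lam i / ((1 + 1 / (d : ℝ)) * lam i + s / (d : ℝ))) :
    (∀ v : Fin p → ℝ,
        (∑ i, (β i) ^ 2 * lam i * w i)
          ≤ ∫ φ, ∑ i, ((X *ᵥ β
              - (X * Matrix.of φ * (Matrix.of φ)ᵀ) *ᵥ v) i) ^ 2 ∂μ) ∧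
    (∫ φ, ∑ i, ((X *ᵥ β - (X * Matrix.of φ * (Matrix.of φ)ᵀ) *ᵥ vstar) i) ^ 2 ∂μ)
      = ∑ i, (β i) ^ 2 * lam i * w i := by
  subst hμ
  have hd' : (0 : ℝ) < d := by exact_mod_cast hd
  have hlam : ∀ l, 0 ≤ lam l := fun l ↦ by
    have h := congrFun (congrFun hdiag l) l
    rw [Matrix.diagonal_apply_eq, Matrix.mul_apply] at h
    rw [← h]
    exact Finset.sum_nonneg fun i _ ↦ mul_self_nonneg (X i l)
  have hs' : s = ∑ l, lam l := by rw [hs, hdiag, Matrix.trace_diagonal]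
  have hls : ∀ l, lam l ≤ s := fun l ↦
    hs' ▸ Finset.single_le_sum (fun i _ ↦ hlam i) (Finset.mem_univ l)
  have hobj : ∀ v : Fin p → ℝ,
      ∫ φ, ∑ i, ((X *ᵥ β - (X * Matrix.of φ * (Matrix.of φ)ᵀ) *ᵥ v) i) ^ 2
        ∂gaussianMatrix p d (d : ℝ≥0)⁻¹
      = ∑ l, (lam l * β l ^ 2 - 2 * lam l * β l * v l
          + ((1 + 1 / (d : ℝ)) * lam l + s / d) * v l ^ 2) := fun v ↦ by
    simp_rw [Matrix.mul_assoc, ← Matrix.mulVec_mulVec v X, ← Matrix.mulVec_sub,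
      sum_mulVec_sq_of_transpose_mul_eq_diagonal hdiag, Pi.sub_apply]
    have h := fun l ↦
      hasIntegral_sub_mulVec_sq_gaussianMatrix (d := d) (d : ℝ≥0)⁻¹ (β l) v l
    rw [integral_finsetSum _ fun l _ ↦ (h l).1.const_mul _]
    simp_rw [integral_const_mul, fun l ↦ (h l).2]
    have hsplit : ∑ l, ((1 + 1 / (d : ℝ)) * lam l + s / d) * v l ^ 2
        = ∑ l, lam l * ((1 + 1 / (d : ℝ)) * v l ^ 2 + (∑ m, v m ^ 2) / d) := by
      have hcross : ∑ l, s / d * v l ^ 2 = ∑ l, lam l * ((∑ m, v m ^ 2) / d) := by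
        rw [← Finset.mul_sum, ← Finset.sum_mul, ← hs']
        ring
      simp_rw [add_mul _ (s / d), mul_add (lam _), Finset.sum_add_distrib, hcross]
      congr 1
      exact Finset.sum_congr rfl fun l _ ↦ by ring
    rw [Finset.sum_add_distrib, hsplit, ← Finset.sum_add_distrib]
    refine Finset.sum_congr rfl fun l _ ↦ ?_
    push_cast
    field_simp
  have hq := fun l ↦ quadratic_min (b := β l) hd' (hlam l) (hls l)
  refine ⟨fun v ↦ ?_, ?_⟩
  · rw [hobj]
    refine Finset.sum_le_sum fun l _ ↦ ?_
    rw [hw]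
    exact (hq l).1 (v l)
  · rw [hobj]
    refine Finset.sum_congr rfl fun l _ ↦ ?_
    rw [hw, hv]
    exact (hq l).2
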